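/- arXiv:1008.0988 — 2 statements merged into one kernel-verified Lean document; each statement's English description precedes it below -/
import Mathlib

section
/- Let U be an orbifold atlas on X and V an orbifold atlas on Y, and let f̃ : U → V be a compatible system for a continuous map f : X → Y. Write (Ṽ_i, H_i, φ_i) := f̃(Ũ_i, G_i, π_i), and let R_U := R̂_U/∼ and R_V := R̂_V/∼ be the quotients constructed from U and V respectively. Then the assignment (λ_ki, x̃_k, λ_kj) ↦ (f̃(λ_ki), f̃_{Ũ_k,Ṽ_k}(x̃_k), f̃(λ_kj)) descends to a well-defined map Ψ : R_U → R_V (independent of the representative of the ∼-class); moreover, defining ψ : ⨿_i Ũ_i → ⨿_i Ṽ_i by ψ = f̃_{Ũ_i,Ṽ_i} on Ũ_i, one has s_V ∘ Ψ = ψ ∘ s_U and t_V ∘ Ψ = ψ ∘ t_U, where s, t send [λ_ki, x̃_k, λ_kj] to (λ_ki(x̃_k), i) and (λ_kj(x̃_k), j) respectively. -/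
open Set

noncomputable section

/-- `ℂⁿ`. -/
abbrev CC (n : ℕ) : Type := EuclideanSpace ℂ (Fin n)

/-- A (reduced complex) uniformizing system of dimension `n` for the open set
`U := p '' Ut` of `X`: `Ut ⊆ ℂⁿ` is a nonempty connected open set, `G` is a finite
group of holomorphic automorphisms of `Ut` (encoded as total maps that agree with the
identity outside `Ut`, so that `G` is honestly a set of maps closed under composition
and inversion), and `p` (the map `π`) is continuous, surjective and `G`-invariant on
`Ut`, inducing a homeomorphism `Ut/G ≃ U` (encoded by: the fibres of `p` on `Ut` are
exactly the `G`-orbits and `p` is an open map on `Ut`). -/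
structure UniformizingSystem (n : ℕ) (X : Type*) [TopologicalSpace X] where
  Ut : Set (CC n)
  isOpen_Ut : IsOpen Ut
  isConnected_Ut : IsConnected Ut
  G : Set (CC n → CC n)
  finite_G : G.Finite
  id_mem_G : (id : CC n → CC n) ∈ G
  comp_mem_G : ∀ g ∈ G, ∀ h ∈ G, (g ∘ h) ∈ G
  inv_mem_G : ∀ g ∈ G, ∃ g' ∈ G, (∀ x, g' (g x) = x) ∧ (∀ x, g (g' x) = x)
  mapsTo_G : ∀ g ∈ G, Set.MapsTo g Ut Ut
  eqOn_id_G : ∀ g ∈ G, Set.EqOn g id Utᶜ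
  analytic_G : ∀ g ∈ G, AnalyticOnNhd ℂ g Ut
  p : CC n → X
  continuousOn_p : ContinuousOn p Ut
  isOpen_image_p : IsOpen (p '' Ut)
  invariant_p : ∀ g ∈ G, ∀ x ∈ Ut, p (g x) = p x
  exists_g_of_p_eq : ∀ x ∈ Ut, ∀ y ∈ Ut, p x = p y → ∃ g ∈ G, g x = y
  isOpenMap_p : ∀ V : Set (CC n), V ⊆ Ut → IsOpen V → IsOpen (p '' V)

/-- The underlying open subset of `X` uniformized by the system. -/
def UniformizingSystem.U {n : ℕ} {X : Type*} [TopologicalSpace X]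
    (𝒰 : UniformizingSystem n X) : Set X := 𝒰.p '' 𝒰.Ut

/-- An embedding `l : (Ũ,G,π) → (Ṽ,H,φ)` of uniformizing systems: a holomorphic
embedding (injective, biholomorphism onto its open image) with `φ ∘ l = π` on `Ũ`. -/
structure IsUSEmbedding {n : ℕ} {X : Type*} [TopologicalSpace X]
    (𝒰 𝒱 : UniformizingSystem n X) (l : CC n → CC n) : Prop where
  mapsTo : Set.MapsTo l 𝒰.Ut 𝒱.Ut
  injOn : Set.InjOn l 𝒰.Ut
  analyticOn : AnalyticOnNhd ℂ l 𝒰.Ut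
  isOpen_image : IsOpen (l '' 𝒰.Ut)
  exists_analytic_inv : ∃ m : CC n → CC n,
    AnalyticOnNhd ℂ m (l '' 𝒰.Ut) ∧ ∀ x ∈ 𝒰.Ut, m (l x) = x
  comp_p : ∀ x ∈ 𝒰.Ut, 𝒱.p (l x) = 𝒰.p x

/-- A (reduced complex) orbifold atlas of dimension `n` on `X`: a family of
uniformizing systems whose underlying open sets cover `X`, such that any two charts
are compatible at every point of the intersection of their underlying open sets. -/
structure OrbifoldAtlas (n : ℕ) (X : Type*) [TopologicalSpace X] where
  I : Type
  chart : I → UniformizingSystem n X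
  covers : ∀ x : X, ∃ i : I, x ∈ (chart i).U
  compat : ∀ i j : I, ∀ x ∈ (chart i).U ∩ (chart j).U,
    ∃ k : I, x ∈ (chart k).U ∧ (chart k).U ⊆ (chart i).U ∩ (chart j).U ∧
      (∃ l, IsUSEmbedding (chart k) (chart i) l) ∧
      (∃ l, IsUSEmbedding (chart k) (chart j) l)

/-- An element of the set `R̂` associated to an orbifold atlas `𝒰`: a triple
`(λ_ki, x̃_k, λ_kj)` consisting of a chart `(Ũ_k, G_k, π_k)` of `𝒰`, a point
`x̃_k ∈ Ũ_k`, and two embeddings of this chart into charts of `𝒰`. -/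
structure RHat {n : ℕ} {X : Type*} [TopologicalSpace X] (𝒰 : OrbifoldAtlas n X) where
  k : 𝒰.I
  i : 𝒰.I
  j : 𝒰.I
  x : CC n
  hx : x ∈ (𝒰.chart k).Ut
  li : CC n → CC n
  lj : CC n → CC n
  hli : IsUSEmbedding (𝒰.chart k) (𝒰.chart i) li
  hlj : IsUSEmbedding (𝒰.chart k) (𝒰.chart j) lj

/-- The relation `∼` on `R̂`: two triples (with the same pairs of target charts) are
related iff there are a chart `(Ũ_m, G_m, π_m)`, a point `x̃_m ∈ Ũ_m` and embeddings
`λ_mk, λ_ml` making the two diagrams (of embeddings and of marked points) commute.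
Triples whose targets have different index pairs are declared not related. -/
def RRel {n : ℕ} {X : Type*} [TopologicalSpace X] (𝒰 : OrbifoldAtlas n X)
    (a b : RHat 𝒰) : Prop :=
  a.i = b.i ∧ a.j = b.j ∧
  ∃ (m : 𝒰.I) (xm : CC n) (_ : xm ∈ (𝒰.chart m).Ut) (mk ml : CC n → CC n),
    IsUSEmbedding (𝒰.chart m) (𝒰.chart a.k) mk ∧
    IsUSEmbedding (𝒰.chart m) (𝒰.chart b.k) ml ∧
    (∀ y ∈ (𝒰.chart m).Ut, a.li (mk y) = b.li (ml y)) ∧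
    (∀ y ∈ (𝒰.chart m).Ut, a.lj (mk y) = b.lj (ml y)) ∧
    mk xm = a.x ∧ ml xm = b.x

/-- A compatible system `f̃ : 𝒰 → 𝒱` for a continuous map `f : X → Y`: a functor from
the category of charts and embeddings of `𝒰` to that of `𝒱` (given by `obj` on charts
and `map` on embeddings, preserving identities and compositions as maps on the relevant
domains), together with holomorphic local liftings `lift i : Ũ_i → Ṽ_i` of `f`
commuting with the projections and compatible with embeddings. -/
structure CompatibleSystem {n : ℕ} {X Y : Type*} [TopologicalSpace X] [TopologicalSpace Y]
    (𝒰 : OrbifoldAtlas n X) (𝒱 : OrbifoldAtlas n Y) (f : X → Y) where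
  obj : 𝒰.I → 𝒱.I
  map : 𝒰.I → 𝒰.I → (CC n → CC n) → (CC n → CC n)
  map_emb : ∀ i j l, IsUSEmbedding (𝒰.chart i) (𝒰.chart j) l →
    IsUSEmbedding (𝒱.chart (obj i)) (𝒱.chart (obj j)) (map i j l)
  map_id : ∀ i : 𝒰.I, Set.EqOn (map i i id) id (𝒱.chart (obj i)).Ut
  map_comp : ∀ i j k l l', IsUSEmbedding (𝒰.chart i) (𝒰.chart j) l →
    IsUSEmbedding (𝒰.chart j) (𝒰.chart k) l' →
    Set.EqOn (map i k (l' ∘ l)) (map j k l' ∘ map i j l) (𝒱.chart (obj i)).Ut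
  lift : 𝒰.I → (CC n → CC n)
  lift_mapsTo : ∀ i, Set.MapsTo (lift i) (𝒰.chart i).Ut (𝒱.chart (obj i)).Ut
  lift_analytic : ∀ i, AnalyticOnNhd ℂ (lift i) (𝒰.chart i).Ut
  lift_comm : ∀ i, ∀ x ∈ (𝒰.chart i).Ut,
    (𝒱.chart (obj i)).p (lift i x) = f ((𝒰.chart i).p x)
  lift_compat : ∀ i j l, IsUSEmbedding (𝒰.chart i) (𝒰.chart j) l →
    ∀ x ∈ (𝒰.chart i).Ut, lift j (l x) = map i j l (lift i x)

/-- The image under a compatible system `F` of a triple `(λ_ki, x̃_k, λ_kj) ∈ R̂_𝒰`: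
the triple `(F(λ_ki), f̃_{Ũ_k,Ṽ_k}(x̃_k), F(λ_kj)) ∈ R̂_𝒱`. -/
def CompatibleSystem.imageR {n : ℕ} {X Y : Type*} [TopologicalSpace X] [TopologicalSpace Y]
    {𝒰 : OrbifoldAtlas n X} {𝒱 : OrbifoldAtlas n Y} {f : X → Y}
    (F : CompatibleSystem 𝒰 𝒱 f) (a : RHat 𝒰) : RHat 𝒱 :=
  ⟨F.obj a.k, F.obj a.i, F.obj a.j, F.lift a.k a.x, F.lift_mapsTo a.k a.hx,
   F.map a.k a.i a.li, F.map a.k a.j a.lj,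
   F.map_emb a.k a.i a.li a.hli, F.map_emb a.k a.j a.lj a.hlj⟩

/-- The source map `s : R̂ → ⨿ᵢ Ũᵢ`, sending `[λ_ki, x̃_k, λ_kj]` to `(λ_ki(x̃_k), i)`. -/
def RHat.s {n : ℕ} {X : Type*} [TopologicalSpace X] {𝒰 : OrbifoldAtlas n X}
    (a : RHat 𝒰) : 𝒰.I × CC n := (a.i, a.li a.x)

/-- The target map `t : R̂ → ⨿ᵢ Ũᵢ`, sending `[λ_ki, x̃_k, λ_kj]` to `(λ_kj(x̃_k), j)`. -/
def RHat.t {n : ℕ} {X : Type*} [TopologicalSpace X] {𝒰 : OrbifoldAtlas n X}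
    (a : RHat 𝒰) : 𝒰.I × CC n := (a.j, a.lj a.x)

/-- The map `ψ : ⨿ᵢ Ũᵢ → ⨿ᵢ Ṽᵢ` induced by a compatible system, equal to the local
lifting `f̃_{Ũ_i,Ṽ_i}` on the component `Ũ_i`. -/
def CompatibleSystem.psi {n : ℕ} {X Y : Type*} [TopologicalSpace X] [TopologicalSpace Y]
    {𝒰 : OrbifoldAtlas n X} {𝒱 : OrbifoldAtlas n Y} {f : X → Y}
    (F : CompatibleSystem 𝒰 𝒱 f) (u : 𝒰.I × CC n) : 𝒱.I × CC n :=
  (F.obj u.1, F.lift u.1 u.2)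

theorem IsUSEmbedding.congr {n : ℕ} {X : Type*} [TopologicalSpace X]
    {𝒜 ℬ : UniformizingSystem n X} {l l' : CC n → CC n}
    (hl : IsUSEmbedding 𝒜 ℬ l) (h : Set.EqOn l l' 𝒜.Ut) : IsUSEmbedding 𝒜 ℬ l' where
  mapsTo := hl.mapsTo.congr h
  injOn := hl.injOn.congr h
  analyticOn := hl.analyticOn.congr 𝒜.isOpen_Ut h
  isOpen_image := h.image_eq ▸ hl.isOpen_image
  exists_analytic_inv := by
    obtain ⟨m, hm, hml⟩ := hl.exists_analytic_inv
    exact ⟨m, h.image_eq ▸ hm, fun x hx => h hx ▸ hml x hx⟩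
  comp_p x hx := h hx ▸ hl.comp_p x hx

theorem IsUSEmbedding.refl {n : ℕ} {X : Type*} [TopologicalSpace X]
    (𝒜 : UniformizingSystem n X) : IsUSEmbedding 𝒜 𝒜 id where
  mapsTo := Set.mapsTo_id _
  injOn := Set.injOn_id _
  analyticOn := analyticOnNhd_id
  isOpen_image := by simpa using 𝒜.isOpen_Ut
  exists_analytic_inv := ⟨id, analyticOnNhd_id, fun _ _ => rfl⟩
  comp_p _ _ := rfl

open Classical in
/-- The action of a compatible system on an embedding only depends on the restriction of the
embedding to the chart. Both embeddings are precomposed with a retraction of `ℂⁿ` onto the chart: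
this retraction is idempotent, so its image under the functor is the identity. -/
theorem CompatibleSystem.map_congr {n : ℕ} {X Y : Type*} [TopologicalSpace X]
    [TopologicalSpace Y] {𝒰 : OrbifoldAtlas n X} {𝒱 : OrbifoldAtlas n Y} {f : X → Y}
    (F : CompatibleSystem 𝒰 𝒱 f) {i j : 𝒰.I} {l l' : CC n → CC n}
    (hl : IsUSEmbedding (𝒰.chart i) (𝒰.chart j) l)
    (h : Set.EqOn l l' (𝒰.chart i).Ut) :
    Set.EqOn (F.map i j l) (F.map i j l') (𝒱.chart (F.obj i)).Ut := by
  obtain ⟨c, hc⟩ := (𝒰.chart i).isConnected_Ut.nonempty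
  set e : CC n → CC n := fun x => if x ∈ (𝒰.chart i).Ut then x else c with he
  have e_eq : Set.EqOn id e (𝒰.chart i).Ut := fun x hx => by simp [he, hx]
  have e_mem : ∀ x, e x ∈ (𝒰.chart i).Ut := fun x => by
    by_cases hx : x ∈ (𝒰.chart i).Ut <;> simp [he, hx, hc]
  have e_emb : IsUSEmbedding (𝒰.chart i) (𝒰.chart i) e := (IsUSEmbedding.refl _).congr e_eq
  have e_idem : e ∘ e = e := funext fun x => (e_eq (e_mem x)).symm
  have comp_e : l ∘ e = l' ∘ e := funext fun x => h (e_mem x)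
  have map_e : ∀ y ∈ (𝒱.chart (F.obj i)).Ut, F.map i i e y = y := fun y hy => by
    have hmap := F.map_emb i i e e_emb
    have hcomp := F.map_comp i i i e e e_emb e_emb hy
    rw [e_idem] at hcomp
    exact (hmap.injOn hy (hmap.mapsTo hy) hcomp).symm
  intro y hy
  have h₁ := F.map_comp i i j e l e_emb hl hy
  have h₂ := F.map_comp i i j e l' e_emb (hl.congr h) hy
  simp only [Function.comp_apply, map_e y hy] at h₁ h₂
  rw [← h₁, ← h₂]
  exact congrArg (fun g => F.map i j g y) comp_e

theorem IsUSEmbedding.comp {n : ℕ} {X : Type*} [TopologicalSpace X]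
    {𝒜 ℬ 𝒞 : UniformizingSystem n X} {l l' : CC n → CC n}
    (hl' : IsUSEmbedding ℬ 𝒞 l') (hl : IsUSEmbedding 𝒜 ℬ l) :
    IsUSEmbedding 𝒜 𝒞 (l' ∘ l) where
  mapsTo := hl'.mapsTo.comp hl.mapsTo
  injOn := hl'.injOn.comp hl.injOn hl.mapsTo
  analyticOn := hl'.analyticOn.comp hl.analyticOn hl.mapsTo
  isOpen_image := by
    obtain ⟨m, hm, hml⟩ := hl'.exists_analytic_inv
    have himage : (l' ∘ l) '' 𝒜.Ut = l' '' ℬ.Ut ∩ m ⁻¹' (l '' 𝒜.Ut) := by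
      ext z
      constructor
      · rintro ⟨x, hx, rfl⟩
        exact ⟨⟨l x, hl.mapsTo hx, rfl⟩, x, hx, (hml _ (hl.mapsTo hx)).symm⟩
      · rintro ⟨⟨y, hy, rfl⟩, x, hx, hxy⟩
        rw [hml y hy] at hxy
        exact ⟨x, hx, congrArg l' hxy⟩
    rw [himage]
    exact hm.continuousOn.isOpen_inter_preimage hl'.isOpen_image hl.isOpen_image
  exists_analytic_inv := by
    obtain ⟨m, hm, hml⟩ := hl.exists_analytic_inv
    obtain ⟨m', hm', hml'⟩ := hl'.exists_analytic_inv
    refine ⟨m ∘ m', hm.comp (hm'.mono ?_) ?_, fun x hx => ?_⟩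
    · rintro _ ⟨x, hx, rfl⟩
      exact ⟨l x, hl.mapsTo hx, rfl⟩
    · rintro _ ⟨x, hx, rfl⟩
      exact ⟨x, hx, (hml' _ (hl.mapsTo hx)).symm⟩
    · simp only [Function.comp_apply, hml' _ (hl.mapsTo hx), hml x hx]
  comp_p x hx := (hl'.comp_p _ (hl.mapsTo hx)).trans (hl.comp_p x hx)

/-- A compatible system sends commutative squares of embeddings to commutative squares. -/
theorem CompatibleSystem.map_comp_eqOn {n : ℕ} {X Y : Type*} [TopologicalSpace X]
    [TopologicalSpace Y] {𝒰 : OrbifoldAtlas n X} {𝒱 : OrbifoldAtlas n Y} {f : X → Y}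
    (F : CompatibleSystem 𝒰 𝒱 f) {m k k' i : 𝒰.I} {l l' g g' : CC n → CC n}
    (hl : IsUSEmbedding (𝒰.chart m) (𝒰.chart k) l)
    (hl' : IsUSEmbedding (𝒰.chart m) (𝒰.chart k') l')
    (hg : IsUSEmbedding (𝒰.chart k) (𝒰.chart i) g)
    (hg' : IsUSEmbedding (𝒰.chart k') (𝒰.chart i) g')
    (h : Set.EqOn (g ∘ l) (g' ∘ l') (𝒰.chart m).Ut) :
    Set.EqOn (F.map k i g ∘ F.map m k l) (F.map k' i g' ∘ F.map m k' l')
      (𝒱.chart (F.obj m)).Ut :=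
  (F.map_comp m k i l g hl hg).symm.trans
    ((F.map_congr (hg.comp hl) h).trans (F.map_comp m k' i l' g' hl' hg'))

/-- A compatible system `f̃ : 𝒰 → 𝒱` induces a well-defined map `Ψ : R_𝒰 → R_𝒱` on
`∼`-classes (the image of a triple only depends on its `∼`-class), and `Ψ` intertwines
the source and target maps with `ψ`: `s_𝒱 ∘ Ψ = ψ ∘ s_𝒰` and `t_𝒱 ∘ Ψ = ψ ∘ t_𝒰`. -/
theorem statement18 {n : ℕ} {X Y : Type*}
    [TopologicalSpace X] [TopologicalSpace Y]
    [T2Space X] [SecondCountableTopology X] [ParacompactSpace X]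
    [T2Space Y] [SecondCountableTopology Y] [ParacompactSpace Y]
    {𝒰 : OrbifoldAtlas n X} {𝒱 : OrbifoldAtlas n Y} {f : X → Y}
    (hf : Continuous f) (F : CompatibleSystem 𝒰 𝒱 f) :
    (∀ a b : RHat 𝒰, RRel 𝒰 a b → RRel 𝒱 (F.imageR a) (F.imageR b)) ∧
    (∀ a : RHat 𝒰, (F.imageR a).s = F.psi a.s ∧ (F.imageR a).t = F.psi a.t) := by
  refine ⟨?_, fun a => ⟨Prod.ext rfl (F.lift_compat a.k a.i a.li a.hli a.x a.hx).symm,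
    Prod.ext rfl (F.lift_compat a.k a.j a.lj a.hlj a.x a.hx).symm⟩⟩
  rintro ⟨k, i, j, x, hx, li, lj, hli, hlj⟩ ⟨k', i', j', x', hx', li', lj', hli', hlj'⟩
    ⟨hi, hj, m, xm, hxm, mk, ml, hmk, hml, hcomm_i, hcomm_j, hmkx, hmlx⟩
  dsimp only at hi hj hmk hml hcomm_i hcomm_j hmkx hmlx
  subst hi hj hmkx hmlx
  exact ⟨rfl, rfl, F.obj m, F.lift m xm, F.lift_mapsTo m hxm, F.map m k mk, F.map m k' ml,
    F.map_emb m k mk hmk, F.map_emb m k' ml hml,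
    F.map_comp_eqOn hmk hml hli hli' hcomm_i, F.map_comp_eqOn hmk hml hlj hlj' hcomm_j,
    (F.lift_compat m k mk hmk xm hxm).symm, (F.lift_compat m k' ml hml xm hxm).symm⟩
end
end

section
/- Let U be an orbifold atlas of dimension n on X, let x ∈ X, and let (Ũ_i, G_i, π_i) and (Ũ_j, G_j, π_j) be charts of U with points x̃_i ∈ Ũ_i and x̃_j ∈ Ũ_j such that π_i(x̃_i) = x = π_j(x̃_j). Then the isotropy subgroups (G_i)_{x̃_i} and (G_j)_{x̃_j} are isomorphic as groups (so the local group of the orbifold at x is well defined up to isomorphism). -/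
open Set

noncomputable section

/-- Two sets of self-maps are isomorphic with respect to composition. -/
def CompIso {α : Type*} (S T : Set (α → α)) : Prop :=
  ∃ Φ : (α → α) → (α → α), Set.BijOn Φ S T ∧
    ∀ g ∈ S, ∀ g' ∈ S, Φ (g ∘ g') = Φ g ∘ Φ g'

theorem CompIso.symm {α : Type*} [Nonempty α] {S T : Set (α → α)} (h : CompIso S T)
    (hS : ∀ g ∈ S, ∀ g' ∈ S, g ∘ g' ∈ S) : CompIso T S := by
  obtain ⟨Φ, hb, hm⟩ := h
  have hinv := hb.invOn_invFunOn
  have hbij : Set.BijOn (Function.invFunOn Φ S) T S := hb.symm hinv.symm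
  refine ⟨Function.invFunOn Φ S, hbij, fun t ht t' ht' => ?_⟩
  have hs := hbij.mapsTo ht
  have hs' := hbij.mapsTo ht'
  have key := hm _ hs _ hs'
  rw [hinv.2 ht, hinv.2 ht'] at key
  rw [← key, hinv.1 (hS _ hs _ hs')]

theorem CompIso.trans {α : Type*} {S T R : Set (α → α)} (h : CompIso S T)
    (h' : CompIso T R) : CompIso S R := by
  obtain ⟨Φ, hb, hm⟩ := h
  obtain ⟨Ψ, hb', hm'⟩ := h'
  refine ⟨Ψ ∘ Φ, hb'.comp hb, fun g hg g' hg' => ?_⟩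
  simp only [Function.comp_apply]
  rw [hm g hg g' hg', hm' _ (hb.mapsTo hg) _ (hb.mapsTo hg')]

/-- If a continuous map agrees at each point of a nonempty open set with one of finitely many
continuous maps, then it agrees with one of them near some point. -/
theorem exists_eventuallyEq_of_finite {E F ι : Type*} [TopologicalSpace E] [TopologicalSpace F]
    [T2Space F] {S : Set ι} (hS : S.Finite) (f : ι → E → F) (k : E → F) {W : Set E}
    (hW : IsOpen W) (hne : W.Nonempty) (hf : ∀ s ∈ S, ContinuousOn (f s) W)
    (hk : ContinuousOn k W) (h : ∀ z ∈ W, ∃ s ∈ S, f s z = k z) :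
    ∃ s ∈ S, ∃ z ∈ W, f s =ᶠ[nhds z] k := by
  induction S, hS using Set.Finite.induction_on generalizing W with
  | empty =>
    obtain ⟨z, hz⟩ := hne
    obtain ⟨s, hs, -⟩ := h z hz
    exact hs.elim
  | @insert s S _ _ ih =>
    by_cases hall : ∀ z ∈ W, f s z = k z
    · obtain ⟨z, hz⟩ := hne
      exact ⟨s, Set.mem_insert _ _, z, hz, Filter.eventuallyEq_of_mem (hW.mem_nhds hz) hall⟩
    · push Not at hall
      obtain ⟨z, hz, hzne⟩ := hall
      have hopen : IsOpen (W ∩ (fun z => (f s z, k z)) ⁻¹' (Set.diagonal F)ᶜ) :=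
        ((hf s (Set.mem_insert _ _)).prodMk hk).isOpen_inter_preimage hW
          isClosed_diagonal.isOpen_compl
      obtain ⟨t, ht, w, hw, he⟩ := ih hopen ⟨z, hz, hzne⟩
        (fun t ht => (hf t (Set.mem_insert_of_mem _ ht)).mono Set.inter_subset_left)
        (hk.mono Set.inter_subset_left) (fun w hw => by
          obtain ⟨t, ht, he⟩ := h w hw.1
          rcases ht with rfl | ht
          · exact (hw.2 he).elim
          · exact ⟨t, ht, he⟩)
      exact ⟨t, Set.mem_insert_of_mem _ ht, w, hw.1, he⟩

/-- If an analytic map on a connected set agrees at each point of a nonempty open subset with one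
of finitely many analytic maps, then it agrees with one of them everywhere. -/
theorem exists_eqOn_of_finite {E F ι : Type*} [NormedAddCommGroup E] [NormedSpace ℂ E]
    [NormedAddCommGroup F] [NormedSpace ℂ F] {S : Set ι} (hS : S.Finite) (f : ι → E → F)
    (k : E → F) {U W : Set E} (hU : IsPreconnected U) (hWU : W ⊆ U)
    (hW : IsOpen W) (hne : W.Nonempty) (hf : ∀ s ∈ S, AnalyticOnNhd ℂ (f s) U)
    (hk : AnalyticOnNhd ℂ k U) (h : ∀ z ∈ W, ∃ s ∈ S, f s z = k z) :
    ∃ s ∈ S, Set.EqOn (f s) k U := by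
  obtain ⟨s, hs, z, hz, he⟩ := exists_eventuallyEq_of_finite hS f k hW hne
    (fun s hs => (hf s hs).continuousOn.mono hWU) (hk.continuousOn.mono hWU) h
  exact ⟨s, hs, (hf s hs).eqOn_of_preconnected_of_eventuallyEq hk hU (hWU hz) he⟩

namespace UniformizingSystem

variable {n : ℕ} {X : Type*} [TopologicalSpace X]

/-- The isotropy group of a point. -/
def isotropy (A : UniformizingSystem n X) (a : CC n) : Set (CC n → CC n) :=
  {g ∈ A.G | g a = a}

theorem comp_mem_isotropy (A : UniformizingSystem n X) (a : CC n) :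
    ∀ g ∈ A.isotropy a, ∀ g' ∈ A.isotropy a, g ∘ g' ∈ A.isotropy a := by
  rintro g ⟨hg, hga⟩ g' ⟨hg', hga'⟩
  exact ⟨A.comp_mem_G g hg g' hg', by simp [hga, hga']⟩

theorem eq_of_eqOn (A : UniformizingSystem n X) {g g' : CC n → CC n} (hg : g ∈ A.G)
    (hg' : g' ∈ A.G) (h : Set.EqOn g g' A.Ut) : g = g' := by
  funext z
  by_cases hz : z ∈ A.Ut
  · exact h hz
  · rw [A.eqOn_id_G g hg hz, A.eqOn_id_G g' hg' hz]

theorem eq_of_eqOn_isOpen (A : UniformizingSystem n X) {g g' : CC n → CC n} (hg : g ∈ A.G)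
    (hg' : g' ∈ A.G) {W : Set (CC n)} (hW : IsOpen W) (hWU : W ⊆ A.Ut) (hne : W.Nonempty)
    (h : Set.EqOn g g' W) : g = g' := by
  obtain ⟨z, hz⟩ := hne
  exact A.eq_of_eqOn hg hg' ((A.analytic_G g hg).eqOn_of_preconnected_of_eventuallyEq
    (A.analytic_G g' hg') A.isConnected_Ut.isPreconnected (hWU hz)
    (Filter.eventuallyEq_of_mem (hW.mem_nhds hz) h))

/-- Isotropy groups of points in the same fibre are conjugate. -/
theorem compIso_isotropy_of_p_eq (A : UniformizingSystem n X) {a b : CC n} (ha : a ∈ A.Ut)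
    (hb : b ∈ A.Ut) (hab : A.p a = A.p b) : CompIso (A.isotropy a) (A.isotropy b) := by
  obtain ⟨k, hk, rfl⟩ := A.exists_g_of_p_eq a ha b hb hab
  obtain ⟨k', hk', hl, hr⟩ := A.inv_mem_G k hk
  refine ⟨fun g => k ∘ g ∘ k', ⟨?_, ?_, ?_⟩, ?_⟩
  · rintro g ⟨hg, hga⟩
    exact ⟨A.comp_mem_G _ hk _ (A.comp_mem_G _ hg _ hk'), by simp [hl, hga]⟩
  · intro g _ g' _ h
    funext z
    have := congrArg k' (congrFun h (k z))
    simpa [hl] using this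
  · rintro h ⟨hh, hhb⟩
    refine ⟨k' ∘ h ∘ k, ⟨A.comp_mem_G _ hk' _ (A.comp_mem_G _ hh _ hk), by simp [hl, hhb]⟩, ?_⟩
    funext z
    simp [hr]
  · intro g _ g' _
    funext z
    simp [hl]

end UniformizingSystem

namespace IsUSEmbedding

variable {n : ℕ} {X : Type*} [TopologicalSpace X] {A B : UniformizingSystem n X}
  {l : CC n → CC n}

theorem exists_intertwining (hl : IsUSEmbedding A B l) {g : CC n → CC n} (hg : g ∈ A.G) :
    ∃ h ∈ B.G, ∀ z ∈ A.Ut, h (l z) = l (g z) := by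
  refine exists_eqOn_of_finite B.finite_G (fun h z => h (l z)) (fun z => l (g z))
    A.isConnected_Ut.isPreconnected subset_rfl A.isOpen_Ut A.isConnected_Ut.nonempty
    (fun h hh => (B.analytic_G h hh).comp hl.analyticOn hl.mapsTo)
    (hl.analyticOn.comp (A.analytic_G g hg) (A.mapsTo_G g hg)) fun z hz => ?_
  have hgz := A.mapsTo_G g hg hz
  exact B.exists_g_of_p_eq _ (hl.mapsTo hz) _ (hl.mapsTo hgz)
    (by rw [hl.comp_p z hz, hl.comp_p _ hgz, A.invariant_p g hg z hz])

theorem exists_intertwining_of_mem_image (hl : IsUSEmbedding A B l) {h : CC n → CC n}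
    (hh : h ∈ B.G) {a : CC n} (ha : a ∈ A.Ut) (hha : h (l a) ∈ l '' A.Ut) :
    ∃ g ∈ A.G, ∀ z ∈ A.Ut, l (g z) = h (l z) := by
  have han : AnalyticOnNhd ℂ (fun z => h (l z)) A.Ut :=
    (B.analytic_G h hh).comp hl.analyticOn hl.mapsTo
  refine exists_eqOn_of_finite (W := A.Ut ∩ (fun z => h (l z)) ⁻¹' (l '' A.Ut)) A.finite_G
    (fun g z => l (g z)) (fun z => h (l z)) A.isConnected_Ut.isPreconnected
    Set.inter_subset_left
    (han.continuousOn.isOpen_inter_preimage A.isOpen_Ut hl.isOpen_image) ⟨a, ha, hha⟩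
    (fun g hg => hl.analyticOn.comp (A.analytic_G g hg) (A.mapsTo_G g hg)) han ?_
  rintro z ⟨hz, w, hw, hwz⟩
  obtain ⟨g, hg, rfl⟩ := A.exists_g_of_p_eq z hz w hw (by
    rw [← hl.comp_p w hw, hwz, B.invariant_p h hh _ (hl.mapsTo hz), hl.comp_p z hz])
  exact ⟨g, hg, hwz⟩

theorem eq_of_comp_eqOn (hl : IsUSEmbedding A B l) {h h' : CC n → CC n} (hh : h ∈ B.G)
    (hh' : h' ∈ B.G) (e : ∀ z ∈ A.Ut, h (l z) = h' (l z)) : h = h' :=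
  B.eq_of_eqOn_isOpen hh hh' hl.isOpen_image hl.mapsTo.image_subset
    (A.isConnected_Ut.nonempty.image l) (Set.forall_mem_image.2 e)

/-- An embedding of uniformizing systems preserves isotropy groups. -/
theorem compIso_isotropy (hl : IsUSEmbedding A B l) {a : CC n} (ha : a ∈ A.Ut) :
    CompIso (A.isotropy a) (B.isotropy (l a)) := by
  choose! Φ hΦ hint using fun (g : CC n → CC n) (hg : g ∈ A.G) => hl.exists_intertwining hg
  refine ⟨Φ, ⟨?_, ?_, ?_⟩, ?_⟩
  · rintro g ⟨hg, hga⟩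
    exact ⟨hΦ g hg, by rw [hint g hg a ha, hga]⟩
  · rintro g ⟨hg, -⟩ g' ⟨hg', -⟩ e
    refine A.eq_of_eqOn hg hg' fun z hz =>
      hl.injOn (A.mapsTo_G g hg hz) (A.mapsTo_G g' hg' hz) ?_
    rw [← hint g hg z hz, ← hint g' hg' z hz, e]
  · rintro h ⟨hh, hha⟩
    obtain ⟨g, hg, e⟩ := hl.exists_intertwining_of_mem_image hh ha ⟨a, ha, hha.symm⟩
    refine ⟨g, ⟨hg, hl.injOn (A.mapsTo_G g hg ha) ha (by rw [e a ha, hha])⟩, ?_⟩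
    exact hl.eq_of_comp_eqOn (hΦ g hg) hh fun z hz => by rw [hint g hg z hz, e z hz]
  · rintro g ⟨hg, -⟩ g' ⟨hg', -⟩
    have hgg := A.comp_mem_G g hg g' hg'
    refine hl.eq_of_comp_eqOn (hΦ _ hgg) (B.comp_mem_G _ (hΦ g hg) _ (hΦ g' hg')) fun z hz => ?_
    rw [hint _ hgg z hz, Function.comp_apply, Function.comp_apply, hint g' hg' z hz,
      hint g hg _ (A.mapsTo_G g' hg' hz)]

end IsUSEmbedding


/-- If `(Ũ_i, G_i, π_i)` and `(Ũ_j, G_j, π_j)` are charts of an orbifold atlas and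
`x̃_i ∈ Ũ_i`, `x̃_j ∈ Ũ_j` lie over the same point `x ∈ X`, then the isotropy groups
`(G_i)_{x̃_i}` and `(G_j)_{x̃_j}` are isomorphic as groups: there is a bijection
between them preserving composition. -/
theorem statement19 {n : ℕ} {X : Type*} [TopologicalSpace X] [T2Space X]
    [SecondCountableTopology X] [ParacompactSpace X]
    (𝒰 : OrbifoldAtlas n X) (i j : 𝒰.I)
    (xi xj : CC n) (hxi : xi ∈ (𝒰.chart i).Ut) (hxj : xj ∈ (𝒰.chart j).Ut)
    (x : X) (hpi : (𝒰.chart i).p xi = x) (hpj : (𝒰.chart j).p xj = x) :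
    ∃ Φ : (CC n → CC n) → (CC n → CC n),
      Set.BijOn Φ {g ∈ (𝒰.chart i).G | g xi = xi} {h ∈ (𝒰.chart j).G | h xj = xj} ∧
      ∀ g ∈ {g ∈ (𝒰.chart i).G | g xi = xi}, ∀ g' ∈ {g ∈ (𝒰.chart i).G | g xi = xi},
        Φ (g ∘ g') = Φ g ∘ Φ g' := by
  change CompIso ((𝒰.chart i).isotropy xi) ((𝒰.chart j).isotropy xj)
  obtain ⟨k, ⟨a, ha, hax⟩, -, ⟨l, hl⟩, ⟨m, hm⟩⟩ :=
    𝒰.compat i j x ⟨⟨xi, hxi, hpi⟩, ⟨xj, hxj, hpj⟩⟩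
  have hi := (hl.compIso_isotropy ha).trans ((𝒰.chart i).compIso_isotropy_of_p_eq
    (hl.mapsTo ha) hxi (by rw [hl.comp_p a ha, hax, hpi]))
  have hj := (hm.compIso_isotropy ha).trans ((𝒰.chart j).compIso_isotropy_of_p_eq
    (hm.mapsTo ha) hxj (by rw [hm.comp_p a ha, hax, hpj]))
  exact (hi.symm ((𝒰.chart k).comp_mem_isotropy a)).trans hj
end
end
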